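/- arXiv:2509.02326 — 3 statements merged into one kernel-verified Lean document; each statement's English description precedes it below -/
import Mathlib

section
/- The largest eigenvalue of A_α satisfies (1/2)·ρ(A_α) ≤ μ₁(A_α) ≤ ρ(A_α). -/
open Finset

open scoped MatrixOrder ComplexOrder in
/-- Rayleigh bound: an upper bound on the eigenvalues of a Hermitian matrix bounds its
quadratic form. -/
theorem Matrix.IsHermitian.re_dotProduct_mulVec_le {ι : Type*} [Fintype ι] [DecidableEq ι]
    {A : Matrix ι ι ℂ} (hA : A.IsHermitian) {c : ℝ} (hc : ∀ i, hA.eigenvalues i ≤ c)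
    (x : ι → ℂ) :
    (star x ⬝ᵥ A.mulVec x).re ≤ c * ∑ i, ‖x i‖ ^ 2 := by
  have hle : A ≤ algebraMap ℝ (Matrix ι ι ℂ) c := by
    refine le_algebraMap_of_spectrum_le (fun r hr => ?_) hA.isSelfAdjoint
    rw [hA.spectrum_real_eq_range_eigenvalues] at hr
    obtain ⟨i, rfl⟩ := hr
    exact hc i
  have h := (Complex.le_def.mp ((Matrix.le_iff.mp hle).dotProduct_mulVec_nonneg x)).1
  rw [Matrix.sub_mulVec, dotProduct_sub, Algebra.algebraMap_eq_smul_one, Matrix.smul_mulVec,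
    Matrix.one_mulVec, dotProduct_smul] at h
  have hx : (star x ⬝ᵥ x).re = ∑ i, ‖x i‖ ^ 2 := by
    simp only [dotProduct, Complex.re_sum, Pi.star_apply, RCLike.star_def,
      ← Complex.normSq_eq_conj_mul_self, Complex.normSq_eq_norm_sq, Complex.ofReal_re]
  simp [hx] at h
  linarith

/-- If the entries of a Hermitian matrix have argument at most `π / 3` in absolute value, then
every eigenvalue is at most twice the largest one in absolute value. -/
theorem Matrix.IsHermitian.abs_eigenvalues_le_two_mul {ι : Type*} [Fintype ι] [DecidableEq ι]
    {A : Matrix ι ι ℂ} (hA : A.IsHermitian) (hre : ∀ v u, ‖A v u‖ ≤ 2 * (A v u).re)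
    {c : ℝ} (hc : ∀ i, hA.eigenvalues i ≤ c) (i : ι) :
    |hA.eigenvalues i| ≤ 2 * c := by
  set x : EuclideanSpace ℂ ι := hA.eigenvectorBasis i with hx
  have hnorm : ∑ j, ‖x j‖ ^ 2 = 1 := by
    rw [← EuclideanSpace.norm_sq_eq, hx, hA.eigenvectorBasis.norm_eq_one, one_pow]
  have habs := hA.re_dotProduct_mulVec_le hc (fun j => (‖x j‖ : ℂ))
  simp only [Complex.norm_real, norm_norm, hnorm, mul_one] at habs
  calc |hA.eigenvalues i| = |(star ⇑x ⬝ᵥ A.mulVec ⇑x).re| := by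
        rw [hA.eigenvalues_eq i]; rfl
    _ ≤ ‖star ⇑x ⬝ᵥ A.mulVec ⇑x‖ := Complex.abs_re_le_norm _
    _ ≤ ∑ v, ∑ u, ‖x v‖ * (‖A v u‖ * ‖x u‖) := by
        refine (norm_sum_le _ _).trans (sum_le_sum fun v _ => ?_)
        rw [norm_mul, ← mul_sum, Pi.star_apply, norm_star]
        refine mul_le_mul_of_nonneg_left ?_ (norm_nonneg _)
        refine (norm_sum_le _ _).trans (sum_le_sum fun u _ => ?_)
        rw [norm_mul]
    _ ≤ ∑ v, ∑ u, 2 * (‖x v‖ * ((A v u).re * ‖x u‖)) := by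
        refine sum_le_sum fun v _ => sum_le_sum fun u _ => ?_
        have := mul_le_mul_of_nonneg_left (hre v u)
          (mul_nonneg (norm_nonneg (x v)) (norm_nonneg (x u)))
        linarith
    _ = 2 * (star (fun j => (‖x j‖ : ℂ)) ⬝ᵥ A.mulVec fun j => (‖x j‖ : ℂ)).re := by
        simp [dotProduct, Matrix.mulVec, mul_sum]
    _ ≤ 2 * c := by linarith

theorem stmt_6
    (n m : ℕ) (hn : 0 < n)
    (G : SimpleGraph (Fin n)) [DecidableRel G.Adj]
    (hm : G.edgeFinset.card = m)
    (H : Matrix (Fin n) (Fin n) ℂ) (hHherm : H.IsHermitian)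
    (hHdiag : ∀ v, H v v = 0)
    (hHzero : ∀ v u, v ≠ u → ¬ G.Adj v u → H v u = 0)
    (hHedge : ∀ v u, G.Adj v u →
      H v u = 1 ∨ H v u = ((1 + Real.sqrt 3 * Complex.I) / 2 : ℂ) ∨ H v u = (starRingEnd ℂ) ((1 + Real.sqrt 3 * Complex.I) / 2 : ℂ))
    (α : ℝ) (hα : α ∈ Set.Icc (0 : ℝ) 1)
    (A : Matrix (Fin n) (Fin n) ℂ)
    (hA : A = (α : ℂ) • Matrix.diagonal (fun i => (G.degree i : ℂ)) + ((1 - α : ℝ) : ℂ) • H)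
    (hAherm : A.IsHermitian)
    (μ : Fin n → ℝ) (hmono : Antitone μ)
    (hperm : ∃ e : Equiv.Perm (Fin n), μ = hAherm.eigenvalues ∘ e)
    (ρ : ℝ) (hρ : IsGreatest (Set.range fun i => |μ i|) ρ) :
    (1 / 2) * ρ ≤ μ ⟨0, hn⟩ ∧ μ ⟨0, hn⟩ ≤ ρ := by
  have hnorm_le : ∀ v u, ‖H v u‖ ≤ 2 * (H v u).re := by
    have hω : ‖((1 + Real.sqrt 3 * Complex.I) / 2 : ℂ)‖ = 1 := by
      rw [← sq_eq_sq₀ (norm_nonneg _) zero_le_one, ← Complex.normSq_eq_norm_sq,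
        Complex.normSq_apply]
      have := Real.mul_self_sqrt (show (0 : ℝ) ≤ 3 by norm_num)
      simp
      linarith
    intro v u
    by_cases hadj : G.Adj v u
    · rcases hHedge v u hadj with h | h | h
      · simp [h]
      · rw [h, hω]; simp
      · rw [h, RCLike.norm_conj, hω, Complex.conj_re]; simp
    · have h : H v u = 0 := by
        by_cases hvu : v = u
        · rw [hvu, hHdiag]
        · exact hHzero v u hvu hadj
      simp [h]
  have hA_le : ∀ v u, ‖A v u‖ ≤ 2 * (A v u).re := by
    intro v u
    by_cases hvu : v = u
    · subst hvu
      have hd : 0 ≤ α * (G.degree v : ℝ) := mul_nonneg hα.1 (Nat.cast_nonneg _)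
      have hentry : A v v = ((α * (G.degree v : ℝ) : ℝ) : ℂ) := by simp [hA, hHdiag]
      rw [hentry, Complex.norm_real, Real.norm_of_nonneg hd, Complex.ofReal_re]
      linarith
    · have hentry : A v u = ((1 - α : ℝ) : ℂ) * H v u := by
        simp [hA, Matrix.diagonal_apply_ne _ hvu]
      have hα' : 0 ≤ 1 - α := sub_nonneg.mpr hα.2
      rw [hentry, norm_mul, Complex.norm_real, Real.norm_of_nonneg hα', Complex.re_ofReal_mul]
      linarith [mul_le_mul_of_nonneg_left (hnorm_le v u) hα']
  obtain ⟨e, rfl⟩ := hperm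
  have hmax : ∀ i, hAherm.eigenvalues i ≤ (hAherm.eigenvalues ∘ e) ⟨0, hn⟩ := by
    intro i
    simpa using hmono (show (⟨0, hn⟩ : Fin n) ≤ e.symm i from Nat.zero_le _)
  obtain ⟨⟨i, rfl⟩, hub⟩ := hρ
  refine ⟨?_, (le_abs_self _).trans (hub ⟨_, rfl⟩)⟩
  have := hAherm.abs_eigenvalues_le_two_mul hA_le hmax (e i)
  simp only [Function.comp_apply] at this ⊢
  linarith
end

section
/- For every j ∈ {1, 2, …, n}, the j-th largest eigenvalue satisfies μ_j(A_α) ≤ 2αm/n + √( ((n−j)/j) · [ nα² Σ_{i=1}^n d_i² + 2mn(1−α)² − 4α²m² ] / n² ). -/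
open Finset

/-- If `y` sums to zero and is at least `t ≥ 0` on `s`, then the sum of squares of `y` bounds `t`. -/
theorem card_mul_sq_le_of_forall_le {n : ℕ} (y : Fin n → ℝ) (hy : ∑ i, y i = 0)
    (s : Finset (Fin n)) {t : ℝ} (ht : 0 ≤ t) (h : ∀ i ∈ s, t ≤ y i) :
    (n : ℝ) * #s * t ^ 2 ≤ ((n : ℝ) - #s) * ∑ i, y i ^ 2 := by
  have hsq : (#s : ℝ) * t ^ 2 ≤ ∑ i ∈ s, y i ^ 2 := by
    rw [← nsmul_eq_mul]
    exact card_nsmul_le_sum _ _ _ fun i hi => pow_le_pow_left₀ ht (h i hi) 2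
  have hsum : (#s : ℝ) * t ≤ ∑ i ∈ s, y i := by
    rw [← nsmul_eq_mul]
    exact card_nsmul_le_sum _ _ _ h
  have hcs : (∑ i ∈ sᶜ, y i) ^ 2 ≤ (#sᶜ : ℝ) * ∑ i ∈ sᶜ, y i ^ 2 := sq_sum_le_card_mul_sum_sq
  have hcard : (#s : ℝ) + #sᶜ = n := by
    exact_mod_cast (card_add_card_compl s).trans (Fintype.card_fin n)
  rw [← sum_add_sum_compl s] at hy ⊢
  rw [show ∑ i ∈ sᶜ, y i = -∑ i ∈ s, y i by linarith, neg_sq] at hcs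
  have hsum' := pow_le_pow_left₀ (by positivity) hsum 2
  have hmul := mul_le_mul_of_nonneg_left hsq (Nat.cast_nonneg (α := ℝ) #sᶜ)
  rw [← hcard]
  linear_combination hmul + hcs + hsum'

/-- The bound on an order statistic in terms of the mean and the standard deviation. -/
theorem Antitone.apply_le_mean_add_sqrt {n : ℕ} {x : Fin n → ℝ} (hx : Antitone x) (k : Fin n) :
    x k ≤ (∑ i, x i) / n + √(((n : ℝ) - (k + 1)) / (k + 1) *
      ((n * ∑ i, x i ^ 2 - (∑ i, x i) ^ 2) / (n : ℝ) ^ 2)) := by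
  have hn : (0 : ℝ) < n := by exact_mod_cast k.pos
  set a := (∑ i, x i) / (n : ℝ) with ha
  have hS : ∑ i, x i = n * a := by rw [ha]; field_simp
  rcases le_total (x k) a with h | h
  · exact h.trans (le_add_of_nonneg_right (Real.sqrt_nonneg _))
  have hy : ∑ i, (x i - a) = 0 := by simp [sum_sub_distrib, hS]
  have key := card_mul_sq_le_of_forall_le (fun i => x i - a) hy (Iic k) (sub_nonneg.2 h)
    fun i hi => sub_le_sub_right (hx (mem_Iic.1 hi)) a
  have hQ : ∑ i, (x i - a) ^ 2 = ∑ i, x i ^ 2 - n * a ^ 2 := by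
    simp only [sub_sq, sum_add_distrib, sum_sub_distrib, ← sum_mul, ← mul_sum, hS, sum_const,
      card_univ, Fintype.card_fin, nsmul_eq_mul]
    ring
  simp only [hQ, Fin.card_Iic, Nat.cast_add, Nat.cast_one] at key
  rw [← sub_le_iff_le_add']
  apply Real.le_sqrt_of_sq_le
  rw [hS, div_mul_div_comm, le_div_iff₀ (by positivity)]
  linear_combination (n : ℝ) * key

theorem Matrix.IsHermitian.sum_eigenvalues_sq {ι : Type*} [Fintype ι] [DecidableEq ι]
    {A : Matrix ι ι ℂ} (hA : A.IsHermitian) :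
    ∑ i, hA.eigenvalues i ^ 2 = ∑ i, ∑ j, Complex.normSq (A i j) := by
  have htrace : (A * A).trace = ∑ i, (hA.eigenvalues i : ℂ) ^ 2 := by
    conv_lhs => rw [hA.spectral_theorem]
    rw [← map_mul, Unitary.conjStarAlgAut_apply, Matrix.trace_mul_cycle, Unitary.coe_star_mul_self,
      one_mul, Matrix.diagonal_mul_diagonal, Matrix.trace_diagonal]
    simp [sq]
  have hentries : (A * A).trace = ∑ i, ∑ j, (Complex.normSq (A i j) : ℂ) := by
    simp only [Matrix.trace, Matrix.diag_apply, Matrix.mul_apply]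
    refine sum_congr rfl fun i _ => sum_congr rfl fun j _ => ?_
    rw [← hA.apply j i, Complex.normSq_eq_conj_mul_self, mul_comm]
    rfl
  exact_mod_cast htrace.symm.trans hentries

theorem Complex.normSq_primitive_sixth_root :
    Complex.normSq ((1 + Real.sqrt 3 * Complex.I) / 2 : ℂ) = 1 := by
  have h : (√3 : ℝ) * √3 = 3 := Real.mul_self_sqrt (by norm_num)
  rw [map_div₀, Complex.normSq_apply]
  norm_num [Complex.normSq_apply, h]

theorem stmt_12
    (n m : ℕ) (hn : 0 < n)
    (G : SimpleGraph (Fin n)) [DecidableRel G.Adj]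
    (hm : G.edgeFinset.card = m)
    (H : Matrix (Fin n) (Fin n) ℂ) (hHherm : H.IsHermitian)
    (hHdiag : ∀ v, H v v = 0)
    (hHzero : ∀ v u, v ≠ u → ¬ G.Adj v u → H v u = 0)
    (hHedge : ∀ v u, G.Adj v u →
      H v u = 1 ∨ H v u = ((1 + Real.sqrt 3 * Complex.I) / 2 : ℂ) ∨ H v u = (starRingEnd ℂ) ((1 + Real.sqrt 3 * Complex.I) / 2 : ℂ))
    (α : ℝ) (hα : α ∈ Set.Icc (0 : ℝ) 1)
    (A : Matrix (Fin n) (Fin n) ℂ)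
    (hA : A = (α : ℂ) • Matrix.diagonal (fun i => (G.degree i : ℂ)) + ((1 - α : ℝ) : ℂ) • H)
    (hAherm : A.IsHermitian)
    (μ : Fin n → ℝ) (hmono : Antitone μ)
    (hperm : ∃ e : Equiv.Perm (Fin n), μ = hAherm.eigenvalues ∘ e)
    (j : ℕ) (hj1 : 1 ≤ j) (hjn : j ≤ n) :
    μ ⟨j - 1, by omega⟩ ≤ 2 * α * m / n +
      Real.sqrt (((n : ℝ) - j) / j * (((n : ℝ) * α ^ 2 * (∑ i, (G.degree i : ℝ) ^ 2) + 2 * (m : ℝ) * n * (1 - α) ^ 2 - 4 * α ^ 2 * (m : ℝ) ^ 2) / (n : ℝ) ^ 2)) := by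
  obtain ⟨e, he⟩ := hperm
  have hdeg : ∑ i, (G.degree i : ℝ) = 2 * m := by
    exact_mod_cast hm ▸ G.sum_degrees_eq_twice_card_edges
  have hsum : ∑ i, μ i = 2 * α * m := by
    have htrace : A.trace = (α : ℂ) * ∑ i, (G.degree i : ℂ) := by
      simp [hA, Matrix.trace, hHdiag, mul_sum]
    rw [hAherm.trace_eq_sum_eigenvalues] at htrace
    have hreal : ∑ i, hAherm.eigenvalues i = α * ∑ i, (G.degree i : ℝ) := by
      rw [← Complex.ofReal_inj]
      simpa using htrace
    simp only [he, Function.comp_apply]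
    rw [Equiv.sum_comp e hAherm.eigenvalues, hreal, hdeg]
    ring
  have hentry : ∀ i j, Complex.normSq (A i j) =
      (if i = j then α ^ 2 * (G.degree i : ℝ) ^ 2 else 0) +
        if G.Adj i j then (1 - α) ^ 2 else 0 := by
    intro i j
    rcases eq_or_ne i j with rfl | hij
    · simp [hA, hHdiag, sq]
    by_cases hadj : G.Adj i j
    · have hnorm : Complex.normSq (H i j) = 1 := by
        rcases hHedge i j hadj with h | h | h
        · simp [h]
        · rw [h, Complex.normSq_primitive_sixth_root]
        · rw [h, Complex.normSq_conj, Complex.normSq_primitive_sixth_root]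
      rw [hA, Matrix.add_apply, Matrix.smul_apply, Matrix.smul_apply,
        Matrix.diagonal_apply_ne _ hij, smul_zero, zero_add, smul_eq_mul, map_mul, hnorm,
        Complex.normSq_ofReal]
      simp [hij, hadj, sq]
    · simp [hA, hij, hadj, hHzero i j hij hadj]
  have hsq : ∑ i, μ i ^ 2 =
      α ^ 2 * ∑ i, (G.degree i : ℝ) ^ 2 + 2 * m * (1 - α) ^ 2 := by
    simp only [he, Function.comp_apply]
    rw [Equiv.sum_comp e fun i => hAherm.eigenvalues i ^ 2, hAherm.sum_eigenvalues_sq]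
    simp only [hentry, sum_add_distrib, sum_ite_eq, mem_univ, if_true, ← mul_sum, ← sum_filter,
      sum_const, ← G.neighborFinset_eq_filter, G.card_neighborFinset_eq_degree, nsmul_eq_mul,
      ← sum_mul, hdeg]
  have hk : ((j - 1 : ℕ) : ℝ) + 1 = j := by exact_mod_cast Nat.sub_add_cancel hj1
  convert hmono.apply_le_mean_add_sqrt ⟨j - 1, by omega⟩ using 2
  · rw [hsum]
  · rw [hsum, hsq, hk]
    congr 3
    ring
end

section
/- Let A be an n×n complex Hermitian matrix with (real) eigenvalues ordered μ₁(A) ≥ μ₂(A) ≥ … ≥ μ_n(A), and set r = tr(A)/n and s = √( tr(A²)/n − r² ). Then r − s·√(n−1) ≤ μ_n(A) ≤ r − s/√(n−1) and r + s/√(n−1) ≤ μ₁(A) ≤ r + s·√(n−1). -/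
open Finset

theorem Matrix.IsHermitian.trace_mul_self_eq_sum_eigenvalues_sq {𝕜 ι : Type*} [RCLike 𝕜]
    [Fintype ι] [DecidableEq ι] {A : Matrix ι ι 𝕜} (hA : A.IsHermitian) :
    (A * A).trace = ∑ i, (hA.eigenvalues i : 𝕜) ^ 2 := by
  conv_lhs => rw [hA.spectral_theorem, ← map_mul, Unitary.conjStarAlgAut_apply,
    Matrix.trace_mul_cycle, Unitary.coe_star_mul_self, one_mul, Matrix.diagonal_mul_diagonal,
    Matrix.trace_diagonal]
  simp [sq]

/-- An entry of a finite family with mean `r` and standard deviation `s` exceeds the mean by at most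
`s * √(N - 1)`, where `N` is the size of the family. -/
theorem le_mean_add_stddev_mul_sqrt {ι : Type*} [Fintype ι] (x : ι → ℝ) (i : ι) {r s : ℝ}
    (hs : 0 ≤ s) (hsum : ∑ j, x j = Fintype.card ι * r)
    (hsq : ∑ j, x j ^ 2 = Fintype.card ι * (s ^ 2 + r ^ 2)) :
    x i ≤ r + s * √((Fintype.card ι : ℝ) - 1) := by
  classical
  have hpos : 0 < Fintype.card ι := Fintype.card_pos_iff.mpr ⟨i⟩
  have hN : (1 : ℝ) ≤ Fintype.card ι := by exact_mod_cast hpos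
  have hcs := sq_sum_le_card_mul_sum_sq (s := univ.erase i) (f := x)
  have hsum' := add_sum_erase univ x (mem_univ i)
  have hsq' := add_sum_erase univ (fun j => x j ^ 2) (mem_univ i)
  rw [card_erase_of_mem (mem_univ i), card_univ, Nat.cast_sub hpos, Nat.cast_one,
    eq_sub_of_add_eq' hsum', eq_sub_of_add_eq' hsq', hsum, hsq] at hcs
  have key : (x i - r) ^ 2 ≤ s ^ 2 * ((Fintype.card ι : ℝ) - 1) := by
    have : (Fintype.card ι : ℝ) * (x i - r) ^ 2
        ≤ Fintype.card ι * (s ^ 2 * ((Fintype.card ι : ℝ) - 1)) := by linarith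
    exact le_of_mul_le_mul_left this (by linarith)
  have := Real.le_sqrt_of_sq_le key
  rw [Real.sqrt_mul (sq_nonneg s), Real.sqrt_sq hs] at this
  linarith

/-- The maximum of a finite family with mean `r` and standard deviation `s` exceeds the mean by at
least `s / √(N - 1)`, where `N ≥ 2` is the size of the family. -/
theorem mean_add_stddev_div_sqrt_le {ι : Type*} [Fintype ι] (x : ι → ℝ) (i : ι) {r s : ℝ}
    (hcard : 2 ≤ Fintype.card ι) (hsum : ∑ j, x j = Fintype.card ι * r)
    (hsq : ∑ j, x j ^ 2 = Fintype.card ι * (s ^ 2 + r ^ 2)) (hmax : ∀ j, x j ≤ x i) :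
    r + s / √((Fintype.card ι : ℝ) - 1) ≤ x i := by
  have hN : (2 : ℝ) ≤ Fintype.card ι := by exact_mod_cast hcard
  have hgap_sum : ∑ j, (x i - x j) = Fintype.card ι * (x i - r) := by
    rw [sum_sub_distrib, hsum, sum_const, card_univ, nsmul_eq_mul]
    ring
  have hgap_sq : ∑ j, (x i - x j) ^ 2 = Fintype.card ι * ((x i - r) ^ 2 + s ^ 2) := by
    simp only [sub_sq, sum_add_distrib, sum_sub_distrib, ← mul_sum, hsum, hsq, sum_const,
      card_univ, nsmul_eq_mul]
    ring
  have hr : r ≤ x i := by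
    have : 0 ≤ (Fintype.card ι : ℝ) * (x i - r) :=
      hgap_sum ▸ sum_nonneg fun j _ => sub_nonneg.mpr (hmax j)
    linarith [nonneg_of_mul_nonneg_right this (by linarith)]
  have hle := sum_sq_le_sq_sum_of_nonneg (s := univ) (f := fun j => x i - x j)
    fun j _ => sub_nonneg.mpr (hmax j)
  rw [hgap_sum, hgap_sq] at hle
  have key : s ^ 2 ≤ (x i - r) ^ 2 * ((Fintype.card ι : ℝ) - 1) := by
    have : (Fintype.card ι : ℝ) * s ^ 2
        ≤ Fintype.card ι * ((x i - r) ^ 2 * ((Fintype.card ι : ℝ) - 1)) := by linarith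
    exact le_of_mul_le_mul_left this (by linarith)
  have hle_sqrt := Real.le_sqrt_of_sq_le key
  rw [Real.sqrt_mul (sq_nonneg _), Real.sqrt_sq (by linarith)] at hle_sqrt
  have := (div_le_iff₀ (Real.sqrt_pos.mpr (by linarith))).mpr hle_sqrt
  linarith

theorem stmt_18
    (n : ℕ) (hn : 2 ≤ n)
    (A : Matrix (Fin n) (Fin n) ℂ) (hAherm : A.IsHermitian)
    (μ : Fin n → ℝ) (hmono : Antitone μ)
    (hperm : ∃ e : Equiv.Perm (Fin n), μ = hAherm.eigenvalues ∘ e)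
    (r s : ℝ) (hr : r = A.trace.re / n)
    (hs : s = Real.sqrt ((A * A).trace.re / n - r ^ 2)) :
    (r - s * Real.sqrt ((n : ℝ) - 1) ≤ μ ⟨n - 1, by omega⟩ ∧
      μ ⟨n - 1, by omega⟩ ≤ r - s / Real.sqrt ((n : ℝ) - 1)) ∧
    (r + s / Real.sqrt ((n : ℝ) - 1) ≤ μ ⟨0, by omega⟩ ∧
      μ ⟨0, by omega⟩ ≤ r + s * Real.sqrt ((n : ℝ) - 1)) := by
  obtain ⟨e, he⟩ := hperm
  have hn0 : (0 : ℝ) < n := by exact_mod_cast (by omega : 0 < n)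
  have htr : ∑ j, μ j = A.trace.re := by
    simp [he, hAherm.trace_eq_sum_eigenvalues, Equiv.sum_comp e hAherm.eigenvalues]
  have htr_sq : ∑ j, μ j ^ 2 = (A * A).trace.re := by
    simp [he, hAherm.trace_mul_self_eq_sum_eigenvalues_sq, ← Complex.ofReal_pow,
      Equiv.sum_comp e fun j => hAherm.eigenvalues j ^ 2]
  have hsum : ∑ j, μ j = Fintype.card (Fin n) * r := by
    rw [htr, hr, Fintype.card_fin, mul_div_cancel₀ _ hn0.ne']
  have hvar : 0 ≤ (A * A).trace.re / n - r ^ 2 := by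
    have hcs := sq_sum_le_card_mul_sum_sq (s := univ) (f := μ)
    rw [htr_sq, hsum, card_univ, Fintype.card_fin, mul_pow, sq (n : ℝ), mul_assoc] at hcs
    rw [sub_nonneg, le_div_iff₀ hn0, mul_comm]
    exact le_of_mul_le_mul_left hcs hn0
  have hsq : ∑ j, μ j ^ 2 = Fintype.card (Fin n) * (s ^ 2 + r ^ 2) := by
    rw [htr_sq, hs, Real.sq_sqrt hvar, sub_add_cancel, Fintype.card_fin,
      mul_div_cancel₀ _ hn0.ne']
  have hs0 : 0 ≤ s := hs ▸ Real.sqrt_nonneg _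
  have hsum_neg : ∑ j, (-μ) j = Fintype.card (Fin n) * (-r) := by
    simp only [Pi.neg_apply, sum_neg_distrib, hsum, mul_neg]
  have hsq_neg : ∑ j, (-μ) j ^ 2 = Fintype.card (Fin n) * (s ^ 2 + (-r) ^ 2) := by
    simp only [Pi.neg_apply, neg_sq, hsq]
  have hcard : 2 ≤ Fintype.card (Fin n) := by rwa [Fintype.card_fin]
  have min_lower := le_mean_add_stddev_mul_sqrt (-μ) ⟨n - 1, by omega⟩ hs0 hsum_neg hsq_neg
  have min_upper := mean_add_stddev_div_sqrt_le (-μ) ⟨n - 1, by omega⟩ hcard hsum_neg hsq_neg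
    fun j => neg_le_neg (hmono (Fin.mk_le_mk.mpr (by omega) : j ≤ ⟨n - 1, by omega⟩))
  have max_lower := mean_add_stddev_div_sqrt_le μ ⟨0, by omega⟩ hcard hsum hsq
    fun j => hmono (Fin.mk_le_mk.mpr (Nat.zero_le j))
  have max_upper := le_mean_add_stddev_mul_sqrt μ ⟨0, by omega⟩ hs0 hsum hsq
  simp only [Pi.neg_apply, Fintype.card_fin] at min_lower min_upper max_lower max_upper
  exact ⟨⟨by linarith, by linarith⟩, max_lower, max_upper⟩
end
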